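/- Fix a positive integer N. Let P be a real polynomial of degree at most N with P(0) = 1 and P'(0) = −1/2, and suppose |P(z)| ≤ 1 for all z ∈ (0, 4N²). Then P(z) = T_N(1 − z/(2N²)), where T_N is the N-th Chebyshev polynomial of the first kind. In particular, for any polynomial P of degree ≤ N with P(0) = 1, P'(0) = −1/2 other than T_N(1 − z/(2N²)), the supremum of those c > 0 such that |P(h²)| ≤ 1 for all h ∈ (0, c) is strictly less than 2N. -/

import Mathlib

open Polynomial

/-- A polynomial of degree at most `N` bounded by `1` on `(0, 4N²)` whose derivative at `0` equals
`-1/2`, that of `T_N(1 - z/(2N²))`, coincides with the latter. -/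
theorem eq_chebyshev_comp_of_abs_le_one {N : ℕ} (hN : 0 < N) {P : ℝ[X]} (hdeg : P.natDegree ≤ N)
    (hder : P.derivative.eval 0 = -(1 / 2))
    (hbound : ∀ z ∈ Set.Ioo (0 : ℝ) (4 * (N : ℝ) ^ 2), |P.eval z| ≤ 1) :
    P = (Chebyshev.T ℝ (N : ℤ)).comp (1 - C (1 / (2 * (N : ℝ) ^ 2)) * X) := by
  have hne : (0 : ℝ) ≠ 4 * (N : ℝ) ^ 2 := by positivity
  have hclosed : ∀ z ∈ Set.Icc (0 : ℝ) (4 * (N : ℝ) ^ 2), |P.eval z| ≤ 1 := by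
    rw [← closure_Ioo hne]
    exact fun z hz => closure_minimal (t := {z : ℝ | |P.eval z| ≤ 1}) hbound
      (isClosed_le P.continuous.abs continuous_const) hz
  set L : ℝ[X] := C (2 * (N : ℝ) ^ 2) * (1 - X) with hL
  have hinv : L.comp (1 - C (1 / (2 * (N : ℝ) ^ 2)) * X) = X := by
    have : C (2 * (N : ℝ) ^ 2) * C (1 / (2 * (N : ℝ) ^ 2)) = 1 := by
      rw [← C_mul, mul_one_div_cancel (by positivity), C_1]
    simp only [hL, mul_comp, C_comp, sub_comp, one_comp, X_comp]
    linear_combination X * this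
  have hLdeg : L.natDegree ≤ 1 := by
    rw [hL]
    compute_degree
  have hQdeg : (P.comp L).degree ≤ N := by
    rw [← natDegree_le_iff_degree_le]
    exact natDegree_comp_le.trans ((Nat.mul_le_mul hdeg hLdeg).trans_eq (mul_one N))
  have hQbound : ∀ x ∈ Set.Icc (-1 : ℝ) 1, |(P.comp L).eval x| ≤ 1 := by
    rintro x ⟨hx, hx'⟩
    rw [eval_comp]
    apply hclosed
    simp only [hL, eval_mul, eval_C, eval_sub, eval_one, eval_X]
    constructor <;> nlinarith [sq_nonneg (N : ℝ)]
  have hQ : P.comp L = Chebyshev.T ℝ N := by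
    rw [← Chebyshev.eval_iterate_derivative_eq_iff_of_bounded one_pos hN le_rfl hQdeg hQbound]
    simp only [Function.iterate_one, Chebyshev.derivative_T_eval_one, derivative_comp, eval_mul,
      eval_comp]
    simp [hL, hder]
    ring
  rw [← hQ, comp_assoc, hinv, comp_X]

/-- If the supremum of the lengths of the intervals `(0, c)` on which a predicate holds is at least
`b > 0`, then the predicate holds on `(0, b)`. -/
theorem forall_mem_Ioo_of_le_sSup {p : ℝ → Prop} {b : ℝ} (hb : 0 < b)
    (h : b ≤ sSup {c : ℝ | 0 < c ∧ ∀ x ∈ Set.Ioo 0 c, p x}) :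
    ∀ x ∈ Set.Ioo 0 b, p x := by
  rintro x ⟨hx, hxb⟩
  have hne : {c : ℝ | 0 < c ∧ ∀ x ∈ Set.Ioo 0 c, p x}.Nonempty := by
    by_contra hempty
    rw [Set.not_nonempty_iff_eq_empty.mp hempty, Real.sSup_empty] at h
    exact hb.not_ge h
  obtain ⟨c, ⟨-, hc⟩, hxc⟩ := exists_lt_of_lt_csSup hne (hxb.trans_le h)
  exact hc x ⟨hx, hxc⟩

/-- Fix `N ≥ 1`.  If `P` is a real polynomial of degree ≤ `N` with
`P(0) = 1`, `P'(0) = −1/2`, and `|P(z)| ≤ 1` for all `z ∈ (0, 4N²)`, then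
`P = T_N(1 − z/(2N²))`, where `T_N` is the `N`-th Chebyshev polynomial of the first kind.
In particular, for any such normalized polynomial `P` other than `T_N(1 − z/(2N²))`, the
supremum of those `c > 0` with `|P(h²)| ≤ 1` for all `h ∈ (0,c)` is strictly below `2N`. -/
theorem strang_verlet_optimal_stability (N : ℕ) (hN : 0 < N) :
    (∀ P : Polynomial ℝ, P.natDegree ≤ N → P.eval 0 = 1 →
      P.derivative.eval 0 = -(1 / 2) →
      (∀ z ∈ Set.Ioo (0 : ℝ) (4 * (N : ℝ) ^ 2), |P.eval z| ≤ 1) →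
      P = (Polynomial.Chebyshev.T ℝ (N : ℤ)).comp
            (1 - Polynomial.C (1 / (2 * (N : ℝ) ^ 2)) * Polynomial.X)) ∧
    (∀ P : Polynomial ℝ, P.natDegree ≤ N → P.eval 0 = 1 →
      P.derivative.eval 0 = -(1 / 2) →
      P ≠ (Polynomial.Chebyshev.T ℝ (N : ℤ)).comp
            (1 - Polynomial.C (1 / (2 * (N : ℝ) ^ 2)) * Polynomial.X) →
      sSup {c : ℝ | 0 < c ∧ ∀ h ∈ Set.Ioo 0 c, |P.eval (h ^ 2)| ≤ 1} < 2 * N) := by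
  refine ⟨fun P hdeg _ hder => eq_chebyshev_comp_of_abs_le_one hN hdeg hder,
    fun P hdeg _ hder hP => ?_⟩
  contrapose! hP
  have hstable := forall_mem_Ioo_of_le_sSup (by positivity) hP
  refine eq_chebyshev_comp_of_abs_le_one hN hdeg hder fun z hz => ?_
  rw [← Real.sq_sqrt hz.1.le]
  refine hstable _ ⟨Real.sqrt_pos.mpr hz.1, ?_⟩
  rw [Real.sqrt_lt' (by positivity)]
  linarith [hz.2, mul_pow 2 (N : ℝ) 2]
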